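/- Fix d ≥ 1 and a modulus of continuity ω. Let ‖M‖^{(1)}_{Op(ω)} be the operator norm of the uncentered maximal operator on ℝ^d when both the balls (cross-polytopes) and the distances in the moduli of continuity are taken with respect to the ℓ₁ norm, and let ‖M‖^{(∞)}_{Op(ω)} be the corresponding operator norm when both the balls (axis-parallel cubes) and the distances are taken with respect to the ℓ∞ norm. Then ‖M‖^{(1)}_{Op(ω)} = ‖M‖^{(∞)}_{Op(ω)}. -/

import Mathlib

open MeasureTheory Set Filter Topology

/-- The closed ball of the norm-like function `N`, with center `c` and radius `R`. -/
def nball {d : ℕ} (N : (Fin d → ℝ) → ℝ) (c : Fin d → ℝ) (R : ℝ) : Set (Fin d → ℝ) :=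
  {y | N (y - c) ≤ R}

/-- The uncentered Hardy–Littlewood maximal function associated to the norm `N`,
with respect to `d`-dimensional Lebesgue measure. -/
noncomputable def maxFn {d : ℕ} (N : (Fin d → ℝ) → ℝ) (f : (Fin d → ℝ) → ℝ)
    (x : Fin d → ℝ) : ℝ :=
  sSup {a : ℝ | ∃ c : Fin d → ℝ, ∃ R : ℝ, 0 < R ∧ x ∈ nball N c R ∧
    a = ⨍ y in nball N c R, |f y|}

/-- The modulus of continuity of `g`, with distances measured using `N`. -/
noncomputable def modCont {d : ℕ} (N : (Fin d → ℝ) → ℝ) (g : (Fin d → ℝ) → ℝ) (δ : ℝ) : ℝ :=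
  sSup {a : ℝ | ∃ x y : Fin d → ℝ, N (x - y) ≤ δ ∧ a = |g x - g y|}

/-- `N` is a norm on `ℝ^d`. -/
structure IsNorm {d : ℕ} (N : (Fin d → ℝ) → ℝ) : Prop where
  eq_zero_iff : ∀ x, N x = 0 ↔ x = 0
  add_le : ∀ x y, N (x + y) ≤ N x + N y
  smul : ∀ (a : ℝ) (x), N (a • x) = |a| * N x

/-- `ω` is a modulus of continuity: continuous, nondecreasing, subadditive on `[0,∞)`,
vanishing at `0`, nonnegative, and not identically zero. -/
structure IsModulus (ω : ℝ → ℝ) : Prop where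
  nonneg : ∀ t, 0 ≤ t → 0 ≤ ω t
  map_zero : ω 0 = 0
  mono : MonotoneOn ω (Ici 0)
  subadd : ∀ a b, 0 ≤ a → 0 ≤ b → ω (a + b) ≤ ω a + ω b
  cont : ContinuousOn ω (Ici 0)
  nontrivial : ∃ t, 0 < t ∧ ω t ≠ 0

/-- The `Lip(ω)` seminorm of `f`: `sup_{t>0} ω(f,t)/ω(t)`. -/
noncomputable def lipNorm {d : ℕ} (N : (Fin d → ℝ) → ℝ) (ω : ℝ → ℝ)
    (f : (Fin d → ℝ) → ℝ) : ℝ :=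
  sSup {a : ℝ | ∃ t : ℝ, 0 < t ∧ a = modCont N f t / ω t}

/-- The operator norm of the uncentered maximal operator on `Lip(ω)`. -/
noncomputable def opNorm (d : ℕ) (N : (Fin d → ℝ) → ℝ) (ω : ℝ → ℝ) : ℝ :=
  sSup {a : ℝ | ∃ f : (Fin d → ℝ) → ℝ, lipNorm N ω f = 1 ∧ a = lipNorm N ω (maxFn N f)}

/-- The Hölder `α` seminorm of `f`, distances measured with `N`. -/
noncomputable def holderNorm {d : ℕ} (N : (Fin d → ℝ) → ℝ) (α : ℝ)
    (f : (Fin d → ℝ) → ℝ) : ℝ :=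
  sSup {a : ℝ | ∃ x y : Fin d → ℝ, x ≠ y ∧ a = |f x - f y| / N (x - y) ^ α}

/-- The operator norm of the uncentered maximal operator on the Hölder class `Lip_α`. -/
noncomputable def opNormHolder (d : ℕ) (N : (Fin d → ℝ) → ℝ) (α : ℝ) : ℝ :=
  sSup {a : ℝ | ∃ f : (Fin d → ℝ) → ℝ, holderNorm N α f = 1 ∧
    a = holderNorm N α (maxFn N f)}

/-- A continuous norm on `ℝ^d` that dominates the sup norm. -/
structure IsDominatingNorm {d : ℕ} (N : (Fin d → ℝ) → ℝ) : Prop extends IsNorm N where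
  cont : Continuous N
  norm_le : ∀ x, ‖x‖ ≤ N x

namespace IsDominatingNorm

variable {d : ℕ} {N : (Fin d → ℝ) → ℝ}

lemma nonneg (hN : IsDominatingNorm N) (x : Fin d → ℝ) : 0 ≤ N x :=
  (norm_nonneg x).trans (hN.norm_le x)

lemma map_zero (hN : IsDominatingNorm N) : N 0 = 0 := (hN.eq_zero_iff 0).2 rfl

lemma map_neg (hN : IsDominatingNorm N) (x : Fin d → ℝ) : N (-x) = N x := by
  simpa using hN.smul (-1) x

lemma map_sub_comm (hN : IsDominatingNorm N) (x y : Fin d → ℝ) : N (x - y) = N (y - x) := by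
  rw [← hN.map_neg, neg_sub]

lemma le_sub_add (hN : IsDominatingNorm N) (x y : Fin d → ℝ) : N x ≤ N (x - y) + N y := by
  simpa using hN.add_le (x - y) y

lemma isClosed_nball (hN : IsDominatingNorm N) (c : Fin d → ℝ) (R : ℝ) :
    IsClosed (nball N c R) :=
  isClosed_le (hN.cont.comp (continuous_id.sub continuous_const)) continuous_const

lemma isCompact_nball (hN : IsDominatingNorm N) (c : Fin d → ℝ) (R : ℝ) :
    IsCompact (nball N c R) := by
  refine Metric.isCompact_of_isClosed_isBounded (hN.isClosed_nball c R) ?_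
  refine Metric.isBounded_closedBall.subset (s := nball N c R) (t := Metric.closedBall c R) ?_
  intro y hy
  rw [mem_closedBall_iff_norm]
  exact (hN.norm_le _).trans hy

lemma measurableSet_nball (hN : IsDominatingNorm N) (c : Fin d → ℝ) (R : ℝ) :
    MeasurableSet (nball N c R) := (hN.isClosed_nball c R).measurableSet

lemma volume_nball_ne_top (hN : IsDominatingNorm N) (c : Fin d → ℝ) (R : ℝ) :
    volume (nball N c R) ≠ ⊤ := (hN.isCompact_nball c R).measure_lt_top.ne

lemma volume_real_nball_pos (hN : IsDominatingNorm N) (c : Fin d → ℝ) {R : ℝ} (hR : 0 < R) :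
    0 < volume.real (nball N c R) := by
  refine ENNReal.toReal_pos ?_ (hN.volume_nball_ne_top c R)
  have ho : IsOpen {y | N (y - c) < R} :=
    isOpen_lt (hN.cont.comp (continuous_id.sub continuous_const)) continuous_const
  have hp : 0 < volume {y | N (y - c) < R} :=
    ho.measure_pos volume ⟨c, by simpa [hN.map_zero] using hR⟩
  exact (hp.trans_le (measure_mono fun y (hy : N (y - c) < R) => hy.le)).ne'

open scoped Pointwise in
lemma setIntegral_nball (hN : IsDominatingNorm N) (c : Fin d → ℝ) {R : ℝ} (hR : 0 < R)
    (h : (Fin d → ℝ) → ℝ) :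
    ∫ y in nball N c R, h y = R ^ d * ∫ u in nball N 0 1, h (c + R • u) := by
  have h1 := Measure.setIntegral_comp_smul_of_pos volume (fun u => h (c + u)) (nball N 0 1) hR
  have h2 : R • nball N 0 1 = (fun u => c + u) ⁻¹' nball N c R := by
    ext x
    simp only [mem_smul_set_iff_inv_smul_mem₀ hR.ne', nball, mem_preimage, mem_ofPred_eq, sub_zero,
      add_sub_cancel_left, hN.smul, abs_of_pos (inv_pos.2 hR)]
    rw [inv_mul_le_iff₀ hR, mul_one]
  rw [h1, h2, (measurePreserving_add_left volume c).setIntegral_preimage_emb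
    (measurableEmbedding_addLeft c)]
  have : R ^ d ≠ 0 := by positivity
  simp [this]

lemma volume_real_nball (hN : IsDominatingNorm N) (c : Fin d → ℝ) {R : ℝ} (hR : 0 < R) :
    volume.real (nball N c R) = R ^ d * volume.real (nball N 0 1) := by
  simpa using hN.setIntegral_nball c hR (fun _ => 1)

lemma volume_real_nball_of_nonneg (hN : IsDominatingNorm N) (hd : 1 ≤ d) (c : Fin d → ℝ) {R : ℝ}
    (hR : 0 ≤ R) : volume.real (nball N c R) = R ^ d * volume.real (nball N 0 1) := by
  rcases hR.eq_or_lt with rfl | hR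
  · have : Nonempty (Fin d) := ⟨⟨0, hd⟩⟩
    have h : nball N c 0 ⊆ {c} := fun y hy => by
      have h0 : N (y - c) = 0 := le_antisymm hy (hN.nonneg _)
      exact sub_eq_zero.1 ((hN.eq_zero_iff _).1 h0)
    have h0 : volume.real (nball N c 0) = 0 := by
      rw [Measure.real, measure_mono_null h (measure_singleton c), ENNReal.toReal_zero]
    rw [h0, zero_pow (by omega), zero_mul]
  · exact hN.volume_real_nball c hR

lemma setAverage_nball (hN : IsDominatingNorm N) (c : Fin d → ℝ) {R : ℝ} (hR : 0 < R)
    (h : (Fin d → ℝ) → ℝ) :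
    ⨍ y in nball N c R, h y = ⨍ u in nball N 0 1, h (c + R • u) := by
  rw [setAverage_eq, setAverage_eq, hN.setIntegral_nball c hR, hN.volume_real_nball c hR]
  have : R ^ d ≠ 0 := by positivity
  simp only [smul_eq_mul]
  field_simp

lemma setAverage_mono (hN : IsDominatingNorm N) {c : Fin d → ℝ} {R : ℝ}
    {g h : (Fin d → ℝ) → ℝ} (hg : Continuous g) (hh : Continuous h)
    (hgh : ∀ y ∈ nball N c R, g y ≤ h y) :
    ⨍ y in nball N c R, g y ≤ ⨍ y in nball N c R, h y := by
  rw [setAverage_eq, setAverage_eq]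
  refine smul_le_smul_of_nonneg_left ?_ (by positivity)
  exact setIntegral_mono_on (hg.continuousOn.integrableOn_compact (hN.isCompact_nball c R))
    (hh.continuousOn.integrableOn_compact (hN.isCompact_nball c R)) (hN.measurableSet_nball c R) hgh

lemma setAverage_add (hN : IsDominatingNorm N) {c : Fin d → ℝ} {R : ℝ}
    {g h : (Fin d → ℝ) → ℝ} (hg : Continuous g) (hh : Continuous h) :
    ⨍ y in nball N c R, (g y + h y) = (⨍ y in nball N c R, g y) + ⨍ y in nball N c R, h y := by
  rw [setAverage_eq, setAverage_eq, setAverage_eq,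
    integral_add (hg.continuousOn.integrableOn_compact (hN.isCompact_nball c R))
    (hh.continuousOn.integrableOn_compact (hN.isCompact_nball c R)), smul_add]

lemma setAverage_nball_const (hN : IsDominatingNorm N) (c : Fin d → ℝ) {R : ℝ} (hR : 0 < R)
    (k : ℝ) : ⨍ _ in nball N c R, k = k := by
  refine setAverage_const ?_ (hN.volume_nball_ne_top c R) k
  intro h
  simpa [Measure.real, h] using hN.volume_real_nball_pos c hR

/-- The average of `|f|` over a ball is controlled by the average over a Minkowski sum of balls. -/
lemma setAverage_le_add (hN : IsDominatingNorm N) {ω : ℝ → ℝ}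
    (hω : Continuous fun u => ω (N u)) {f : (Fin d → ℝ) → ℝ} (hf : Continuous f)
    (hfω : ∀ x y, |f x - f y| ≤ ω (N (x - y))) (c c₀ : Fin d → ℝ) {R R₀ : ℝ} (hR : 0 < R)
    (hR₀ : 0 < R₀) :
    ⨍ y in nball N c R, |f y| ≤
      (⨍ y in nball N (c + c₀) (R + R₀), |f y|) + ⨍ u in nball N c₀ R₀, ω (N u) := by
  have hω' : Continuous fun u => ω (N (c₀ + R₀ • u)) :=
    hω.comp (g := fun u => ω (N u)) (f := fun u => c₀ + R₀ • u) (by fun_prop)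
  rw [hN.setAverage_nball c hR, hN.setAverage_nball _ (add_pos hR hR₀), hN.setAverage_nball c₀ hR₀,
    ← hN.setAverage_add (by fun_prop) hω']
  refine hN.setAverage_mono (by fun_prop) (.add (by fun_prop) hω') fun u _ => ?_
  have h := hfω (c + R • u) (c + c₀ + (R + R₀) • u)
  rw [hN.map_sub_comm, show c + c₀ + (R + R₀) • u - (c + R • u) = c₀ + R₀ • u by module] at h
  have := abs_sub_abs_le_abs_sub (f (c + R • u)) (f (c + c₀ + (R + R₀) • u))
  linarith

end IsDominatingNorm

namespace IsModulus

variable {ω : ℝ → ℝ}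

lemma natCast_mul_le (hω : IsModulus ω) {t : ℝ} (ht : 0 ≤ t) (n : ℕ) : ω (n * t) ≤ n * ω t := by
  induction n with
  | zero => simp [hω.map_zero]
  | succ n ih =>
    have h := hω.subadd (n * t) t (by positivity) ht
    push_cast
    rw [add_mul, add_mul, one_mul, one_mul]
    linarith

lemma pos (hω : IsModulus ω) {t : ℝ} (ht : 0 < t) : 0 < ω t := by
  refine (hω.nonneg t ht.le).lt_of_ne fun h => ?_
  obtain ⟨T, hT, hT0⟩ := hω.nontrivial
  obtain ⟨n, hn⟩ := exists_nat_ge (T / t)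
  have h1 : T ≤ n * t := (div_le_iff₀ ht).1 hn
  have h2 := hω.natCast_mul_le ht.le n
  rw [← h, mul_zero] at h2
  exact hT0 (le_antisymm ((hω.mono hT.le (hT.le.trans h1) h1).trans h2) (hω.nonneg T hT.le))

lemma continuous_comp {d : ℕ} {N : (Fin d → ℝ) → ℝ} (hω : IsModulus ω)
    (hN : IsDominatingNorm N) : Continuous fun u => ω (N u) :=
  hω.cont.comp_continuous hN.cont hN.nonneg

lemma sub_le_comp {d : ℕ} {N : (Fin d → ℝ) → ℝ} (hω : IsModulus ω)
    (hN : IsDominatingNorm N) (x y : Fin d → ℝ) : ω (N x) - ω (N y) ≤ ω (N (x - y)) := by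
  have h1 := hω.mono (hN.nonneg x) (add_nonneg (hN.nonneg (x - y)) (hN.nonneg y))
    (hN.le_sub_add x y)
  have h2 := hω.subadd _ _ (hN.nonneg (x - y)) (hN.nonneg y)
  linarith

end IsModulus

/-- `f` has modulus of continuity at most `ω` with respect to `N`. -/
def HasModulus {d : ℕ} (N : (Fin d → ℝ) → ℝ) (ω : ℝ → ℝ) (f : (Fin d → ℝ) → ℝ) : Prop :=
  ∀ x y, |f x - f y| ≤ ω (N (x - y))

namespace HasModulus

variable {d : ℕ} {N : (Fin d → ℝ) → ℝ} {ω : ℝ → ℝ} {f : (Fin d → ℝ) → ℝ}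

lemma of_sub_le (hN : IsDominatingNorm N) (h : ∀ x y, f x - f y ≤ ω (N (x - y))) :
    HasModulus N ω f := fun x y => by
  refine abs_sub_le_iff.2 ⟨h x y, ?_⟩
  rw [hN.map_sub_comm]
  exact h y x

lemma continuous (hN : IsDominatingNorm N) (hω : IsModulus ω) (hf : HasModulus N ω f) :
    Continuous f := by
  refine continuous_iff_continuousAt.2 fun x => ?_
  refine tendsto_iff_norm_sub_tendsto_zero.2 ?_
  have h : Tendsto (fun y => ω (N (y - x))) (𝓝 x) (𝓝 (ω (N (x - x)))) :=
    ((hω.continuous_comp hN).comp (continuous_id.sub continuous_const)).tendsto x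
  rw [sub_self, hN.map_zero, hω.map_zero] at h
  exact squeeze_zero (fun y => norm_nonneg _) (fun y => hf y x) h

lemma modCont_le (hω : IsModulus ω) (hN : IsDominatingNorm N) (hf : HasModulus N ω f) {t : ℝ}
    (ht : 0 ≤ t) : modCont N f t ≤ ω t := by
  refine Real.sSup_le ?_ (hω.nonneg t ht)
  rintro a ⟨x, y, hxy, rfl⟩
  exact (hf x y).trans (hω.mono (hN.nonneg _) ht hxy)

lemma le_modCont (hω : IsModulus ω) (hN : IsDominatingNorm N) (hf : HasModulus N ω f)
    (x y : Fin d → ℝ) : |f x - f y| ≤ modCont N f (N (x - y)) := by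
  refine le_csSup ⟨ω (N (x - y)), ?_⟩ ⟨x, y, le_rfl, rfl⟩
  rintro a ⟨z, w, hzw, rfl⟩
  exact (hf z w).trans (hω.mono (hN.nonneg _) (hN.nonneg _) hzw)

lemma div_le_one (hω : IsModulus ω) (hN : IsDominatingNorm N) (hf : HasModulus N ω f) {t : ℝ}
    (ht : 0 < t) : modCont N f t / ω t ≤ 1 :=
  (div_le_one₀ (hω.pos ht)).2 (hf.modCont_le hω hN ht.le)

lemma lipNorm_le_one (hω : IsModulus ω) (hN : IsDominatingNorm N) (hf : HasModulus N ω f) :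
    lipNorm N ω f ≤ 1 := by
  refine Real.sSup_le ?_ zero_le_one
  rintro a ⟨t, ht, rfl⟩
  exact hf.div_le_one hω hN ht

lemma le_mul_lipNorm (hω : IsModulus ω) (hN : IsDominatingNorm N) (hf : HasModulus N ω f)
    {x y : Fin d → ℝ} (hxy : 0 < N (x - y)) :
    |f x - f y| ≤ ω (N (x - y)) * lipNorm N ω f := by
  refine (hf.le_modCont hω hN x y).trans ?_
  rw [mul_comm, ← div_le_iff₀ (hω.pos hxy)]
  refine le_csSup ⟨1, ?_⟩ ⟨_, hxy, rfl⟩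
  rintro a ⟨t, ht, rfl⟩
  exact hf.div_le_one hω hN ht

end HasModulus

lemma bddAbove_oscillation_natCast_mul {d : ℕ} {N : (Fin d → ℝ) → ℝ} (hN : IsDominatingNorm N)
    {f : (Fin d → ℝ) → ℝ} {t b : ℝ} (hb : ∀ x y, N (x - y) ≤ t → |f x - f y| ≤ b) (n : ℕ) :
    ∀ x y, N (x - y) ≤ n * t → |f x - f y| ≤ n * b := by
  induction n with
  | zero =>
    intro x y h
    have h0 : N (x - y) = 0 := le_antisymm (by simpa using h) (hN.nonneg _)
    simp [sub_eq_zero.1 ((hN.eq_zero_iff _).1 h0)]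
  | succ n ih =>
    intro x y h
    push_cast at h ⊢
    have hn : (0 : ℝ) < n + 1 := by positivity
    set z := x + ((n : ℝ) + 1)⁻¹ • (y - x) with hz
    have h1 : N (x - z) ≤ t := by
      rw [show x - z = ((n : ℝ) + 1)⁻¹ • (x - y) by rw [hz]; module, hN.smul,
        abs_of_pos (inv_pos.2 hn), inv_mul_le_iff₀ hn]
      exact h
    have h2 : N (z - y) ≤ n * t := by
      have hzy : z - y = ((n : ℝ) * ((n : ℝ) + 1)⁻¹) • (x - y) := by
        have : (n : ℝ) * ((n : ℝ) + 1)⁻¹ = 1 - ((n : ℝ) + 1)⁻¹ := by field_simp; ring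
        rw [this, hz]; module
      rw [hzy, hN.smul, abs_of_nonneg (by positivity), mul_assoc]
      refine mul_le_mul_of_nonneg_left ?_ (Nat.cast_nonneg n)
      rw [inv_mul_le_iff₀ hn]
      exact h
    have := abs_sub_le (f x) (f z) (f y)
    linarith [hb _ _ h1, ih _ _ h2]

lemma hasModulus_of_lipNorm_eq_one {d : ℕ} {N : (Fin d → ℝ) → ℝ} (hN : IsDominatingNorm N)
    {ω : ℝ → ℝ} (hω : IsModulus ω) {f : (Fin d → ℝ) → ℝ} (hf : lipNorm N ω f = 1) :
    HasModulus N ω f := by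
  have hS : BddAbove {a : ℝ | ∃ t : ℝ, 0 < t ∧ a = modCont N f t / ω t} := by
    by_contra h
    rw [lipNorm, Real.sSup_of_not_bddAbove h] at hf
    exact zero_ne_one hf
  have hle : ∀ t, 0 < t → modCont N f t ≤ ω t := fun t ht => by
    rw [← div_le_one₀ (hω.pos ht), ← hf]
    exact le_csSup hS ⟨t, ht, rfl⟩
  have hbdd : ∀ t, 0 < t →
      BddAbove {a : ℝ | ∃ x y : Fin d → ℝ, N (x - y) ≤ t ∧ a = |f x - f y|} := by
    intro t ht
    by_contra h
    have hall : ∀ s, 0 < s → modCont N f s = 0 := by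
      intro s hs
      refine Real.sSup_of_not_bddAbove ?_
      rintro ⟨b, hb⟩
      obtain ⟨n, hn⟩ := exists_nat_ge (t / s)
      refine h ⟨n * b, ?_⟩
      rintro a ⟨x, y, hxy, rfl⟩
      exact bddAbove_oscillation_natCast_mul hN (fun x y hxy => hb ⟨x, y, hxy, rfl⟩) n x y
        (hxy.trans ((div_le_iff₀ hs).1 hn))
    have : lipNorm N ω f ≤ 0 := by
      refine Real.sSup_le ?_ le_rfl
      rintro a ⟨s, hs, rfl⟩
      rw [hall s hs, zero_div]
    linarith
  intro x y
  rcases (hN.nonneg (x - y)).eq_or_lt with h | h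
  · simp [sub_eq_zero.1 ((hN.eq_zero_iff _).1 h.symm), hN.map_zero, hω.map_zero]
  · exact (le_csSup (hbdd _ h) ⟨x, y, le_rfl, rfl⟩).trans (hle _ h)

/-- The averages of `|f|` over balls containing `x`. -/
def ballAverages {d : ℕ} (N : (Fin d → ℝ) → ℝ) (f : (Fin d → ℝ) → ℝ) (x : Fin d → ℝ) : Set ℝ :=
  {a : ℝ | ∃ c : Fin d → ℝ, ∃ R : ℝ, 0 < R ∧ x ∈ nball N c R ∧ a = ⨍ y in nball N c R, |f y|}

namespace HasModulus

variable {d : ℕ} {N : (Fin d → ℝ) → ℝ} {ω : ℝ → ℝ} {f : (Fin d → ℝ) → ℝ}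

lemma ballAverages_le (hN : IsDominatingNorm N) (hω : IsModulus ω) (hf : HasModulus N ω f)
    {x y c₀ : Fin d → ℝ} {R₀ : ℝ} (hR₀ : 0 < R₀) (h : N (y - x - c₀) ≤ R₀) {a : ℝ}
    (ha : a ∈ ballAverages N f x) :
    ∃ b ∈ ballAverages N f y, a ≤ b + ⨍ u in nball N c₀ R₀, ω (N u) := by
  obtain ⟨c, R, hR, hx, rfl⟩ := ha
  refine ⟨_, ⟨c + c₀, R + R₀, add_pos hR hR₀, ?_, rfl⟩,
    hN.setAverage_le_add (hω.continuous_comp hN) (hf.continuous hN hω) hf c c₀ hR hR₀⟩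
  have := hN.add_le (x - c) (y - x - c₀)
  rw [show x - c + (y - x - c₀) = y - (c + c₀) by abel] at this
  exact this.trans (add_le_add hx h)

lemma bddAbove_ballAverages (hN : IsDominatingNorm N) (hω : IsModulus ω) (hf : HasModulus N ω f)
    (x y : Fin d → ℝ) (hy : BddAbove (ballAverages N f y)) : BddAbove (ballAverages N f x) := by
  obtain ⟨b, hb⟩ := hy
  refine ⟨b + ⨍ u in nball N (y - x) 1, ω (N u), fun a ha => ?_⟩
  obtain ⟨b', hb', h⟩ := hf.ballAverages_le hN hω (y := y) (c₀ := y - x) one_pos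
    (by simp [hN.map_zero]) ha
  exact h.trans (add_le_add_left (hb hb') _)

lemma maxFn_sub_le (hN : IsDominatingNorm N) (hω : IsModulus ω) (hf : HasModulus N ω f)
    {x y c₀ : Fin d → ℝ} {R₀ : ℝ} (hR₀ : 0 < R₀) (h : N (y - x - c₀) ≤ R₀) :
    maxFn N f x - maxFn N f y ≤ ⨍ u in nball N c₀ R₀, ω (N u) := by
  have h0 : 0 ≤ ⨍ u in nball N c₀ R₀, ω (N u) := by
    rw [setAverage_eq]
    exact mul_nonneg (by positivity) (integral_nonneg fun u => hω.nonneg _ (hN.nonneg u))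
  by_cases hy : BddAbove (ballAverages N f y)
  · have hy0 : 0 ≤ maxFn N f y := by
      refine Real.sSup_nonneg ?_
      rintro a ⟨c, R, hR, hx, rfl⟩
      rw [setAverage_eq]
      exact mul_nonneg (by positivity) (integral_nonneg fun u => abs_nonneg _)
    rw [sub_le_iff_le_add']
    refine Real.sSup_le (fun a ha => ?_) (by positivity)
    obtain ⟨b, hb, hab⟩ := hf.ballAverages_le hN hω hR₀ h ha
    exact hab.trans (add_le_add_left (le_csSup hy hb) _)
  · have hx : ¬ BddAbove (ballAverages N f x) := fun hx => hy (hf.bddAbove_ballAverages hN hω y x hx)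
    have e1 : maxFn N f x = 0 := Real.sSup_of_not_bddAbove hx
    have e2 : maxFn N f y = 0 := Real.sSup_of_not_bddAbove hy
    rw [e1, e2, sub_zero]
    exact h0

/-- The maximal function does not increase the modulus of continuity. -/
lemma maxFn (hN : IsDominatingNorm N) (hω : IsModulus ω) (hf : HasModulus N ω f) :
    HasModulus N ω (maxFn N f) := by
  refine of_sub_le hN fun x y => ?_
  rcases (hN.nonneg (x - y)).eq_or_lt with h | h
  · simp [sub_eq_zero.1 ((hN.eq_zero_iff _).1 h.symm), hN.map_zero, hω.map_zero]
  have h2 : 0 < N (x - y) / 2 := by positivity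
  have hc : N ((1 / 2 : ℝ) • (y - x)) = N (x - y) / 2 := by
    rw [hN.smul, hN.map_sub_comm y x, abs_of_pos (by norm_num)]; ring
  refine (hf.maxFn_sub_le hN hω (c₀ := (1 / 2 : ℝ) • (y - x)) h2 ?_).trans ?_
  · rw [← hc, show y - x - (1 / 2 : ℝ) • (y - x) = (1 / 2 : ℝ) • (y - x) by module]
  · rw [← hN.setAverage_nball_const ((1 / 2 : ℝ) • (y - x)) h2 (ω (N (x - y)))]
    refine hN.setAverage_mono (hω.continuous_comp hN) continuous_const fun u hu => ?_
    refine hω.mono (hN.nonneg _) (hN.nonneg _) ?_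
    have := hN.le_sub_add u ((1 / 2 : ℝ) • (y - x))
    have hu' : N (u - (1 / 2 : ℝ) • (y - x)) ≤ N (x - y) / 2 := hu
    linarith

end HasModulus

lemma IsModulus.integral_min_le_of_distribution_le {X Y : Type*} [MeasurableSpace X]
    [MeasurableSpace Y] {μ : Measure X} {ν : Measure Y} [IsProbabilityMeasure μ]
    [IsProbabilityMeasure ν] {ω : ℝ → ℝ} (hω : IsModulus ω) {p : X → ℝ} {q : Y → ℝ}
    (hp : Measurable p) (hq : Measurable q) (hp0 : ∀ x, 0 ≤ p x) (hq0 : ∀ y, 0 ≤ q y)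
    (hωp : Measurable fun x => ω (p x)) (hωq : Measurable fun y => ω (q y)) {δ : ℝ} (hδ : 0 ≤ δ)
    (h : ∀ s, 0 ≤ s → s < δ → ν {y | q y ≤ s} ≤ μ {x | p x ≤ s}) :
    ∫ x, min (ω (p x)) (ω δ) ∂μ ≤ ∫ y, min (ω (q y)) (ω δ) ∂ν := by
  have hp1 : ∀ x, 0 ≤ min (ω (p x)) (ω δ) := fun x => le_min (hω.nonneg _ (hp0 x)) (hω.nonneg _ hδ)
  have hq1 : ∀ y, 0 ≤ min (ω (q y)) (ω δ) := fun y => le_min (hω.nonneg _ (hq0 y)) (hω.nonneg _ hδ)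
  have hpm : Measurable fun x => min (ω (p x)) (ω δ) := hωp.min measurable_const
  have hqm : Measurable fun y => min (ω (q y)) (ω δ) := hωq.min measurable_const
  rw [integral_eq_lintegral_of_nonneg_ae (ae_of_all _ hp1) hpm.aestronglyMeasurable,
    integral_eq_lintegral_of_nonneg_ae (ae_of_all _ hq1) hqm.aestronglyMeasurable]
  refine ENNReal.toReal_mono ?_ ?_
  · have : ∫⁻ y, ENNReal.ofReal (min (ω (q y)) (ω δ)) ∂ν ≤ ∫⁻ _, ENNReal.ofReal (ω δ) ∂ν :=
      lintegral_mono fun y => ENNReal.ofReal_le_ofReal (min_le_right _ _)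
    refine (this.trans_lt ?_).ne
    simp
  rw [lintegral_eq_lintegral_meas_lt μ (ae_of_all _ hp1) hpm.aemeasurable,
    lintegral_eq_lintegral_meas_lt ν (ae_of_all _ hq1) hqm.aemeasurable]
  refine setLIntegral_mono' measurableSet_Ioi fun l hl => ?_
  have hl0 : 0 < l := hl
  rcases le_or_gt (ω δ) l with hlδ | hlδ
  · have : {x | l < min (ω (p x)) (ω δ)} = ∅ := by
      ext x
      simp [hlδ]
    rw [this, measure_empty]
    exact zero_le
  have hK : IsCompact {s ∈ Icc 0 δ | ω s ≤ l} := by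
    refine isCompact_Icc.of_isClosed_subset ?_ fun s hs => hs.1
    exact (hω.cont.mono fun s hs => hs.1).preimage_isClosed_of_isClosed isClosed_Icc isClosed_Iic
  obtain ⟨s, hs, hmax⟩ := hK.exists_isGreatest ⟨0, ⟨le_rfl, hδ⟩, by rw [hω.map_zero]; exact hl0.le⟩
  have hsδ : s < δ := hs.1.2.lt_of_ne fun e => by
    have := hs.2
    rw [e] at this
    linarith
  have key : ∀ r, 0 ≤ r → (l < min (ω r) (ω δ) ↔ ¬ r ≤ s) := by
    intro r hr
    rw [lt_min_iff, and_iff_left hlδ]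
    refine ⟨fun h1 h2 => ?_, fun h1 => ?_⟩
    · have := hω.mono hr hs.1.1 h2
      linarith [hs.2]
    · by_contra! h2
      rcases le_total r δ with h3 | h3
      · exact h1 (hmax ⟨⟨hr, h3⟩, h2⟩)
      · have := hω.mono hδ hr h3
        linarith
  have e1 : {x | l < min (ω (p x)) (ω δ)} = {x | p x ≤ s}ᶜ := by
    ext x
    exact key _ (hp0 x)
  have e2 : {y | l < min (ω (q y)) (ω δ)} = {y | q y ≤ s}ᶜ := by
    ext y
    exact key _ (hq0 y)
  rw [e1, e2, prob_compl_eq_one_sub (measurableSet_le hp measurable_const),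
    prob_compl_eq_one_sub (measurableSet_le hq measurable_const)]
  exact tsub_le_tsub_left (h s hs.1.1 hsδ) 1

/-- In the direction `e`, the intersection of a ball with a ball centered at the origin is never
larger than for a ball centered on the line spanned by `e`. -/
structure IsExtremalDirection {d : ℕ} (N : (Fin d → ℝ) → ℝ) (e : Fin d → ℝ) : Prop where
  map_eq_one : N e = 1
  inter_le : ∀ (δ : ℝ) (c : Fin d → ℝ) (R s : ℝ), N (δ • e - c) ≤ R →
    ∃ c', volume.real (nball N c R ∩ nball N 0 s) ≤ volume.real (nball N c' ((s + 2 * R - δ) / 2))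

lemma nball_mono {d : ℕ} {N : (Fin d → ℝ) → ℝ} {c : Fin d → ℝ} {r R : ℝ} (h : r ≤ R) :
    nball N c r ⊆ nball N c R := fun _ hy => le_trans hy h

namespace IsExtremalDirection

variable {d : ℕ} {N N' : (Fin d → ℝ) → ℝ} {e : Fin d → ℝ}

lemma volume_inter_le (he : IsExtremalDirection N e) (hd : 1 ≤ d) (hN : IsDominatingNorm N)
    {δ R s k : ℝ} {c : Fin d → ℝ} (hc : N (δ • e - c) ≤ R) (hk : 0 ≤ k)
    (h : s ≤ k ∨ (s + 2 * R - δ) / 2 ≤ k) :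
    volume.real (nball N c R ∩ nball N 0 s) ≤ k ^ d * volume.real (nball N 0 1) := by
  rcases h with h | h
  · rw [← hN.volume_real_nball_of_nonneg hd 0 hk]
    exact measureReal_mono (inter_subset_right.trans (nball_mono h)) (hN.volume_nball_ne_top _ _)
  · obtain ⟨c', hc'⟩ := he.inter_le δ c R s hc
    rw [← hN.volume_real_nball_of_nonneg hd c' hk]
    exact hc'.trans (measureReal_mono (nball_mono h) (hN.volume_nball_ne_top _ _))

lemma _root_.exists_overlap_parameter {δ R : ℝ} (hδ : 0 < δ) (hR : 0 < R) :
    ∃ t, 0 ≤ t ∧ t ≤ δ ∧ ∀ s, 0 ≤ s → s ≤ δ →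
      s ≤ R * ((s + min s t) / (δ + t)) ∨
        (s + 2 * R - δ) / 2 ≤ R * ((s + min s t) / (δ + t)) := by
  rcases le_total (2 * R) δ with h1 | h1
  · refine ⟨0, le_rfl, hδ.le, fun s hs hsδ => Or.inr ?_⟩
    rw [min_eq_right hs, add_zero, add_zero, mul_div_assoc', le_div_iff₀ hδ]
    nlinarith [mul_nonneg (sub_nonneg.2 h1) (sub_nonneg.2 hsδ)]
  rcases le_total R δ with h2 | h2
  · refine ⟨2 * R - δ, by linarith, by linarith, fun s hs hsδ => ?_⟩
    have e1 : R * ((s + min s (2 * R - δ)) / (δ + (2 * R - δ))) = (s + min s (2 * R - δ)) / 2 := by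
      rw [add_sub_cancel]
      field_simp
    rw [e1]
    rcases le_total s (2 * R - δ) with h3 | h3
    · left
      rw [min_eq_left h3]
      linarith
    · right
      rw [min_eq_right h3]
      linarith
  · refine ⟨δ, hδ.le, le_rfl, fun s hs hsδ => Or.inl ?_⟩
    rw [min_eq_left hsδ, mul_div_assoc', le_div_iff₀ (by positivity)]
    nlinarith [mul_nonneg hs (sub_nonneg.2 h2)]

lemma _root_.IsDominatingNorm.le_volume_inter (hN : IsDominatingNorm N) (hd : 1 ≤ d) {δ s t : ℝ}
    (hδ : 0 < δ) (hs : 0 ≤ s) (hsδ : s ≤ δ) (ht : 0 ≤ t) (htδ : t ≤ δ) {v : Fin d → ℝ}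
    (hv : N v = δ) :
    ((s + min s t) / 2) ^ d * volume.real (nball N 0 1) ≤
      volume.real (nball N (((δ - t) / (2 * δ)) • v) ((δ + t) / 2) ∩ nball N 0 s) := by
  set m := min s t with hm
  have hm0 : 0 ≤ m := le_min hs ht
  have hms : m ≤ s := min_le_left _ _
  have hmt : m ≤ t := min_le_right _ _
  rw [← hN.volume_real_nball_of_nonneg hd (((s - m) / (2 * δ)) • v) (by positivity)]
  have hle : s - m ≤ δ - t := by
    rcases min_choice s t with h | h <;> rw [← hm] at h <;> linarith
  refine measureReal_mono (fun u (hu : N (u - _) ≤ _) => ⟨?_, ?_⟩)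
    (measure_ne_top_of_subset inter_subset_right (hN.volume_nball_ne_top 0 s))
  · have h1 := hN.add_le (u - ((s - m) / (2 * δ)) • v)
      ((((s - m) / (2 * δ)) • v) - ((δ - t) / (2 * δ)) • v)
    rw [sub_add_sub_cancel, ← sub_smul, hN.smul, hv, ← sub_div, abs_div,
      abs_of_nonpos (by linarith : s - m - (δ - t) ≤ 0), abs_of_pos (by positivity : 0 < 2 * δ)] at h1
    have h2 : -(s - m - (δ - t)) / (2 * δ) * δ = (δ - t - s + m) / 2 := by field_simp; ring
    rw [h2] at h1
    change N _ ≤ _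
    linarith
  · have h1 := hN.le_sub_add u (((s - m) / (2 * δ)) • v)
    rw [hN.smul, hv, abs_of_nonneg (div_nonneg (by linarith) (by positivity))] at h1
    have h2 : (s - m) / (2 * δ) * δ = (s - m) / 2 := by field_simp
    rw [h2] at h1
    change N (u - 0) ≤ s
    rw [sub_zero]
    linarith

/-- For every ball of the norm `N` through `δ • e`, there is a ball of `N'` through a given point
`v` at distance `δ` from the origin on which distances to the origin are stochastically smaller. -/
lemma exists_nball (he : IsExtremalDirection N e) (hd : 1 ≤ d) (hN : IsDominatingNorm N)
    (hN' : IsDominatingNorm N') {δ R : ℝ} (hδ : 0 < δ) (hR : 0 < R) {c v : Fin d → ℝ}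
    (hc : N (δ • e - c) ≤ R) (hv : N' v = δ) :
    ∃ c₀ R₀, 0 < R₀ ∧ N' (v - c₀) ≤ R₀ ∧ (∀ u ∈ nball N' c₀ R₀, N' u ≤ δ) ∧
      ∀ s, 0 ≤ s → s < δ →
        (volume.real (nball N c R))⁻¹ * volume.real (nball N c R ∩ nball N 0 s) ≤
          (volume.real (nball N' c₀ R₀))⁻¹ * volume.real (nball N' c₀ R₀ ∩ nball N' 0 s) := by
  obtain ⟨t, ht, htδ, h⟩ := exists_overlap_parameter hδ hR
  have hc₀ : N' (((δ - t) / (2 * δ)) • v) = (δ - t) / 2 := by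
    rw [hN'.smul, hv, abs_of_nonneg (div_nonneg (by linarith) (by positivity))]
    field_simp
  refine ⟨((δ - t) / (2 * δ)) • v, (δ + t) / 2, by positivity, ?_, fun u hu => ?_,
    fun s hs hsδ => ?_⟩
  · have : v - ((δ - t) / (2 * δ)) • v = ((δ + t) / (2 * δ)) • v := by
      rw [show (δ + t) / (2 * δ) = 1 - (δ - t) / (2 * δ) by field_simp; ring]
      module
    rw [this, hN'.smul, hv, abs_of_nonneg (by positivity)]
    apply le_of_eq
    field_simp
  · have h1 := hN'.le_sub_add u (((δ - t) / (2 * δ)) • v)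
    have h2 : N' (u - ((δ - t) / (2 * δ)) • v) ≤ (δ + t) / 2 := hu
    linarith
  · have hm : 0 ≤ min s t := le_min hs ht
    have hV := hN.volume_real_nball_pos 0 one_pos
    have hV' := hN'.volume_real_nball_pos 0 one_pos
    have h1 := he.volume_inter_le hd hN hc (k := R * ((s + min s t) / (δ + t))) (by positivity)
      (h s hs hsδ.le)
    have h2 := hN'.le_volume_inter hd hδ hs hsδ.le ht htδ hv
    rw [hN.volume_real_nball c hR, hN'.volume_real_nball _ (by positivity : 0 < (δ + t) / 2)]
    calc _ ≤ (R ^ d * volume.real (nball N 0 1))⁻¹ *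
          ((R * ((s + min s t) / (δ + t))) ^ d * volume.real (nball N 0 1)) := by gcongr
      _ = ((s + min s t) / (δ + t)) ^ d := by
        rw [mul_pow]
        field_simp
      _ = (((δ + t) / 2) ^ d * volume.real (nball N' 0 1))⁻¹ *
          (((s + min s t) / 2) ^ d * volume.real (nball N' 0 1)) := by
        rw [div_pow, div_pow, div_pow]
        field_simp
      _ ≤ _ := by gcongr

/-- Averages of `ω ∘ N'` over suitable balls through `v` are smaller than averages of the truncation
of `ω ∘ N` over a ball through `δ • e`. -/
lemma exists_setAverage_le (he : IsExtremalDirection N e) (hd : 1 ≤ d) (hN : IsDominatingNorm N)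
    (hN' : IsDominatingNorm N') {ω : ℝ → ℝ} (hω : IsModulus ω) {δ R : ℝ} (hδ : 0 < δ) (hR : 0 < R)
    {c v : Fin d → ℝ} (hc : N (δ • e - c) ≤ R) (hv : N' v = δ) :
    ∃ c₀ R₀, 0 < R₀ ∧ N' (v - c₀) ≤ R₀ ∧
      ⨍ u in nball N' c₀ R₀, ω (N' u) ≤ ⨍ u in nball N c R, min (ω (N u)) (ω δ) := by
  obtain ⟨c₀, R₀, hR₀, hv₀, hle, hvol⟩ := he.exists_nball hd hN hN' hδ hR hc hv
  refine ⟨c₀, R₀, hR₀, hv₀, ?_⟩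
  have h1 : ⨍ u in nball N' c₀ R₀, ω (N' u) ≤ ⨍ u in nball N' c₀ R₀, min (ω (N' u)) (ω δ) :=
    hN'.setAverage_mono (hω.continuous_comp hN')
      ((hω.continuous_comp hN').min continuous_const) fun u hu =>
        le_min le_rfl (hω.mono (hN'.nonneg u) hδ.le (hle u hu))
  refine h1.trans ?_
  have hpos : ∀ {N : (Fin d → ℝ) → ℝ} (_ : IsDominatingNorm N) (c : Fin d → ℝ) {R : ℝ} (_ : 0 < R),
      IsProbabilityMeasure (ProbabilityTheory.cond volume (nball N c R)) := by
    intro N hN c R hR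
    refine ProbabilityTheory.cond_isProbabilityMeasure_of_finite ?_ (hN.volume_nball_ne_top c R)
    intro h
    simpa [Measure.real, h] using hN.volume_real_nball_pos c hR
  have := hpos hN c hR
  have := hpos hN' c₀ hR₀
  rw [setAverage_eq', setAverage_eq']
  refine hω.integral_min_le_of_distribution_le (μ := ProbabilityTheory.cond volume (nball N' c₀ R₀))
    (ν := ProbabilityTheory.cond volume (nball N c R)) hN'.cont.measurable hN.cont.measurable
    hN'.nonneg hN.nonneg (hω.continuous_comp hN').measurable (hω.continuous_comp hN).measurable
    hδ.le fun s hs hsδ => ?_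
  rw [← ENNReal.toReal_le_toReal (measure_ne_top _ _) (measure_ne_top _ _),
    ProbabilityTheory.cond_apply (hN.measurableSet_nball c R),
    ProbabilityTheory.cond_apply (hN'.measurableSet_nball c₀ R₀)]
  have h := hvol s hs hsδ
  simpa [nball, ENNReal.toReal_mul, ENNReal.toReal_inv, Measure.real] using h

end IsExtremalDirection

/-- The truncated radial function `(ω(δ) - ω(N z))₊`. -/
def radialBump {d : ℕ} (N : (Fin d → ℝ) → ℝ) (ω : ℝ → ℝ) (δ : ℝ) (z : Fin d → ℝ) : ℝ :=
  max (ω δ - ω (N z)) 0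

section RadialBump

variable {d : ℕ} {N : (Fin d → ℝ) → ℝ} {ω : ℝ → ℝ} {δ : ℝ}

lemma abs_radialBump_add_min (z : Fin d → ℝ) :
    |radialBump N ω δ z| + min (ω (N z)) (ω δ) = ω δ := by
  rw [radialBump, abs_of_nonneg (le_max_right _ _)]
  rcases le_total (ω (N z)) (ω δ) with h | h
  · rw [max_eq_left (by linarith), min_eq_left h]; ring
  · rw [max_eq_right (by linarith), min_eq_right h]; ring

lemma hasModulus_radialBump (hN : IsDominatingNorm N) (hω : IsModulus ω) :
    HasModulus N ω (radialBump N ω δ) := by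
  refine HasModulus.of_sub_le hN fun x y => ?_
  have h := hω.sub_le_comp hN y x
  rw [hN.map_sub_comm] at h
  have h0 := hω.nonneg _ (hN.nonneg (x - y))
  unfold radialBump
  rw [sub_le_iff_le_add]
  have h1 := le_max_left (ω δ - ω (N y)) 0
  have h2 := le_max_right (ω δ - ω (N y)) 0
  exact max_le (by linarith) (by linarith)

lemma lipNorm_radialBump (hN : IsDominatingNorm N) (hω : IsModulus ω) (hδ : 0 < δ)
    {e : Fin d → ℝ} (he : N e = 1) : lipNorm N ω (radialBump N ω δ) = 1 := by
  have hb := hasModulus_radialBump (δ := δ) hN hω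
  refine le_antisymm (hb.lipNorm_le_one hω hN) ?_
  have hδe : N (δ • e) = δ := by rw [hN.smul, he, abs_of_pos hδ, mul_one]
  have h := hb.le_mul_lipNorm hω hN (x := δ • e) (y := 0) (by rwa [sub_zero, hδe])
  have h0 := hω.pos hδ
  rw [sub_zero, hδe, radialBump, radialBump, hδe, hN.map_zero, hω.map_zero, sub_self, max_self,
    sub_zero, max_eq_left h0.le, zero_sub, abs_neg, abs_of_pos h0] at h
  exact (le_mul_iff_one_le_right h0).1 h

lemma setAverage_radialBump (hN : IsDominatingNorm N) (hω : IsModulus ω) (c : Fin d → ℝ) {R : ℝ}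
    (hR : 0 < R) :
    ⨍ y in nball N c R, |radialBump N ω δ y| =
      ω δ - ⨍ y in nball N c R, min (ω (N y)) (ω δ) := by
  rw [eq_sub_iff_add_eq, ← hN.setAverage_add
    ((hasModulus_radialBump hN hω).continuous hN hω).abs
    ((hω.continuous_comp hN).min continuous_const)]
  simp only [abs_radialBump_add_min]
  exact hN.setAverage_nball_const c hR _

lemma le_maxFn_radialBump_zero (hN : IsDominatingNorm N) (hω : IsModulus ω) (hδ : 0 < δ) :
    ω δ ≤ maxFn N (radialBump N ω δ) 0 := by
  have hbdd : BddAbove (ballAverages N (radialBump N ω δ) 0) := by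
    refine ⟨ω δ, ?_⟩
    rintro a ⟨c, R, hR, -, rfl⟩
    rw [← hN.setAverage_nball_const c hR (ω δ)]
    refine hN.setAverage_mono ((hasModulus_radialBump hN hω).continuous hN hω).abs
      continuous_const fun y _ => ?_
    have h := abs_radialBump_add_min (N := N) (ω := ω) (δ := δ) y
    have := le_min (hω.nonneg _ (hN.nonneg y)) (hω.nonneg δ hδ.le)
    linarith
  have hr : ∀ r, 0 < r → ω δ - maxFn N (radialBump N ω δ) 0 ≤ ω r := by
    intro r hr
    have h1 : ω δ - ⨍ y in nball N 0 r, min (ω (N y)) (ω δ) ≤ maxFn N (radialBump N ω δ) 0 :=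
      le_csSup hbdd ⟨0, r, hr, by simp [nball, hN.map_zero, hr.le],
        (setAverage_radialBump hN hω 0 hr).symm⟩
    have h2 : ⨍ y in nball N 0 r, min (ω (N y)) (ω δ) ≤ ω r := by
      rw [← hN.setAverage_nball_const 0 hr (ω r)]
      refine hN.setAverage_mono ((hω.continuous_comp hN).min continuous_const) continuous_const
        fun y hy => (min_le_left _ _).trans (hω.mono (hN.nonneg y) hr.le ?_)
      simpa [nball] using hy
    linarith
  have hlim : Tendsto ω (𝓝[>] 0) (𝓝 0) := by
    have h := hω.cont 0 self_mem_Ici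
    rw [ContinuousWithinAt, hω.map_zero] at h
    exact h.mono_left (nhdsWithin_mono _ Ioi_subset_Ici_self)
  have := ge_of_tendsto hlim (eventually_mem_nhdsWithin.mono fun r h => hr r h)
  linarith

end RadialBump

namespace IsExtremalDirection

variable {d : ℕ} {N N' : (Fin d → ℝ) → ℝ} {e : Fin d → ℝ} {ω : ℝ → ℝ}

/-- The oscillation of `maxFn N' f` is controlled by that of the maximal function of a radial bump
with respect to a norm having an extremal direction. -/
lemma maxFn_sub_le_maxFn_radialBump_sub (he : IsExtremalDirection N e) (hd : 1 ≤ d)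
    (hN : IsDominatingNorm N) (hN' : IsDominatingNorm N') (hω : IsModulus ω)
    {f : (Fin d → ℝ) → ℝ} (hf : HasModulus N' ω f) {x y : Fin d → ℝ} {δ : ℝ} (hδ : 0 < δ)
    (hxy : N' (x - y) = δ) :
    maxFn N' f x - maxFn N' f y ≤
      maxFn N (radialBump N ω δ) 0 - maxFn N (radialBump N ω δ) (δ • e) := by
  have h0 := le_maxFn_radialBump_zero hN hω hδ
  have h1 : maxFn N (radialBump N ω δ) (δ • e) ≤ ω δ - (maxFn N' f x - maxFn N' f y) := by
    refine Real.sSup_le ?_ ?_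
    · rintro a ⟨c, R, hR, hc, rfl⟩
      rw [setAverage_radialBump hN hω c hR]
      obtain ⟨c₀, R₀, hR₀, hv, hle⟩ := he.exists_setAverage_le hd hN hN' hω hδ hR hc
        (v := y - x) (by rw [hN'.map_sub_comm, hxy])
      have := hf.maxFn_sub_le hN' hω hR₀ hv
      linarith
    · have := (le_abs_self _).trans (hf.maxFn hN' hω x y)
      rw [hxy] at this
      linarith
  linarith

lemma opNorm_le (he : IsExtremalDirection N e) (hd : 1 ≤ d) (hN : IsDominatingNorm N)
    (hN' : IsDominatingNorm N') (hω : IsModulus ω) : opNorm d N' ω ≤ opNorm d N ω := by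
  have hmod : ∀ f, lipNorm N ω f = 1 → HasModulus N ω (maxFn N f) := fun f hf =>
    (hasModulus_of_lipNorm_eq_one hN hω hf).maxFn hN hω
  have hK : 0 ≤ opNorm d N ω := by
    refine Real.sSup_nonneg ?_
    rintro a ⟨f, hf, rfl⟩
    refine Real.sSup_nonneg ?_
    rintro a ⟨t, ht, rfl⟩
    refine div_nonneg (Real.sSup_nonneg ?_) (hω.nonneg t ht.le)
    rintro a ⟨x, y, -, rfl⟩
    exact abs_nonneg _
  refine Real.sSup_le ?_ hK
  rintro a ⟨f, hf, rfl⟩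
  have hf := hasModulus_of_lipNorm_eq_one hN' hω hf
  have key : ∀ x y, maxFn N' f x - maxFn N' f y ≤ opNorm d N ω * ω (N' (x - y)) := by
    intro x y
    rcases (hN'.nonneg (x - y)).eq_or_lt with h | h
    · simp [sub_eq_zero.1 ((hN'.eq_zero_iff _).1 h.symm), hN'.map_zero, hω.map_zero]
    have hL := lipNorm_radialBump hN hω h he.map_eq_one
    have hδe : N (0 - N' (x - y) • e) = N' (x - y) := by
      rw [zero_sub, hN.map_neg, hN.smul, he.map_eq_one, abs_of_pos h, mul_one]
    have h1 := he.maxFn_sub_le_maxFn_radialBump_sub hd hN hN' hω hf h rfl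
    have h2 := (le_abs_self _).trans
      ((hmod _ hL).le_mul_lipNorm hω hN (x := 0) (y := N' (x - y) • e) (by rwa [hδe]))
    have h3 : lipNorm N ω (_root_.maxFn N (radialBump N ω (N' (x - y)))) ≤ opNorm d N ω := by
      refine le_csSup ⟨1, ?_⟩ ⟨_, hL, rfl⟩
      rintro a ⟨g, hg, rfl⟩
      exact (hmod g hg).lipNorm_le_one hω hN
    rw [hδe] at h2
    calc _ ≤ _ := h1.trans h2
      _ ≤ ω (N' (x - y)) * opNorm d N ω := mul_le_mul_of_nonneg_left h3 (hω.nonneg _ h.le)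
      _ = _ := mul_comm _ _
  refine Real.sSup_le ?_ hK
  rintro a ⟨t, ht, rfl⟩
  rw [div_le_iff₀ (hω.pos ht)]
  refine Real.sSup_le ?_ (mul_nonneg hK (hω.nonneg t ht.le))
  rintro a ⟨x, y, hxy, rfl⟩
  have habs : |maxFn N' f x - maxFn N' f y| ≤ opNorm d N ω * ω (N' (x - y)) :=
    HasModulus.of_sub_le (ω := fun t => opNorm d N ω * ω t) hN' key x y
  exact habs.trans (mul_le_mul_of_nonneg_left (hω.mono (hN'.nonneg _) ht.le hxy) hK)

end IsExtremalDirection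

lemma isDominatingNorm_norm (d : ℕ) : IsDominatingNorm (fun x : Fin d → ℝ => ‖x‖) where
  eq_zero_iff _ := norm_eq_zero
  add_le := norm_add_le
  smul a x := by rw [norm_smul, Real.norm_eq_abs]
  cont := continuous_norm
  norm_le _ := le_rfl

lemma isDominatingNorm_sum_abs (d : ℕ) :
    IsDominatingNorm (fun x : Fin d → ℝ => ∑ i, |x i|) where
  eq_zero_iff x := by
    rw [Finset.sum_eq_zero_iff_of_nonneg fun i _ => abs_nonneg _]
    simp [funext_iff]
  add_le x y := by
    rw [← Finset.sum_add_distrib]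
    exact Finset.sum_le_sum fun i _ => abs_add_le _ _
  smul a x := by simp [abs_mul, Finset.mul_sum]
  cont := by fun_prop
  norm_le x := by
    refine (pi_norm_le_iff_of_nonneg (Finset.sum_nonneg fun i _ => abs_nonneg _)).2 fun i => ?_
    exact Finset.single_le_sum (f := fun i => |x i|) (fun i _ => abs_nonneg _) (Finset.mem_univ i)

lemma isExtremalDirection_norm {d : ℕ} (hd : 1 ≤ d) :
    IsExtremalDirection (fun x : Fin d → ℝ => ‖x‖) 1 where
  map_eq_one := by
    have : Nonempty (Fin d) := ⟨⟨0, hd⟩⟩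
    exact norm_one
  inter_le δ c R s h := by
    have : Nonempty (Fin d) := ⟨⟨0, hd⟩⟩
    refine ⟨fun _ => (s - 2 * R + δ) / 2, ?_⟩
    refine measureReal_mono (fun u hu => ?_)
      ((isDominatingNorm_norm d).volume_nball_ne_top _ _)
    have h1 : ‖u - c‖ ≤ R := hu.1
    have h2 : ‖u - 0‖ ≤ s := hu.2
    change ‖_‖ ≤ _
    rw [pi_norm_le_iff_of_nonempty] at h h1 h2 ⊢
    intro i
    have h := abs_le.1 (h i)
    have h1 := abs_le.1 (h1 i)
    have h2 := abs_le.1 (h2 i)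
    simp only [Pi.sub_apply, Pi.smul_apply, Pi.one_apply, Pi.zero_apply, smul_eq_mul] at h h1 h2
    exact abs_le.2 ⟨by simp only [Pi.sub_apply]; linarith, by simp only [Pi.sub_apply]; linarith⟩

lemma isExtremalDirection_sum_abs (n : ℕ) :
    IsExtremalDirection (fun x : Fin (n + 1) → ℝ => ∑ i, |x i|) (Pi.single 0 1) where
  map_eq_one := by simp [Fin.sum_univ_succ]
  inter_le δ c R s h := by
    have hN := isDominatingNorm_sum_abs (n + 1)
    set N := fun x : Fin (n + 1) → ℝ => ∑ i, |x i| with hNdef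
    set m : Fin (n + 1) → ℝ := Pi.single 0 ((s - 2 * R + δ) / 2) with hm
    set w : Fin (n + 1) → ℝ := Function.update c 0 0 with hw
    set B := nball N m ((s + 2 * R - δ) / 2) with hB
    set I := nball N c R ∩ nball N 0 s with hI
    set A := {u : Fin (n + 1) → ℝ | s - |u 0| ≤ R - |u 0 - c 0|} with hA
    have hAm : MeasurableSet A :=
      measurableSet_le (by fun_prop) (by fun_prop)
    have hIm : MeasurableSet I := (hN.measurableSet_nball _ _).inter (hN.measurableSet_nball _ _)
    have hBt : volume B ≠ ⊤ := hN.volume_nball_ne_top _ _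
    have hIt : volume I ≠ ⊤ := measure_ne_top_of_subset inter_subset_left (hN.volume_nball_ne_top _ _)
    have hc0 : δ - c 0 ≤ R := by
      refine (le_abs_self _).trans (le_trans ?_ h)
      have := Finset.single_le_sum (f := fun i => |(δ • (Pi.single 0 1 : Fin (n + 1) → ℝ) - c) i|)
        (fun i _ => abs_nonneg _) (Finset.mem_univ 0)
      simpa using this
    have memB : ∀ u : Fin (n + 1) → ℝ, u ∈ B ↔
        |u 0 - (s - 2 * R + δ) / 2| + ∑ i : Fin n, |u i.succ| ≤ (s + 2 * R - δ) / 2 := by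
      intro u
      simp [hB, hNdef, nball, Fin.sum_univ_succ, hm]
    have memI : ∀ u : Fin (n + 1) → ℝ, u ∈ I ↔
        |u 0 - c 0| + ∑ i : Fin n, |u i.succ - c i.succ| ≤ R ∧
          |u 0| + ∑ i : Fin n, |u i.succ| ≤ s := by
      intro u
      simp [hI, hNdef, nball, Fin.sum_univ_succ]
    have bound : ∀ a r : ℝ, r ≤ s - |a| → r ≤ R - |a - c 0| →
        |a - (s - 2 * R + δ) / 2| + r ≤ (s + 2 * R - δ) / 2 := by
      intro a r h1 h2
      have h3 := le_abs_self a
      have h4 := neg_abs_le (a - c 0)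
      rcases abs_cases (a - (s - 2 * R + δ) / 2) with ⟨h5, -⟩ | ⟨h5, -⟩ <;> rw [h5] <;> linarith
    set T := (fun u => u + w) ⁻¹' (I \ A) with hT
    have hTm : MeasurableSet T := (measurable_add_const w) (hIm.diff hAm)
    have hTv : volume.real T = volume.real (I \ A) := by
      rw [Measure.real, hT, measure_preimage_add_right, Measure.real]
    have hw0 : w 0 = 0 := by simp [hw]
    have hws : ∀ i : Fin n, w i.succ = c i.succ := fun i => by simp [hw]
    have hsub1 : I ∩ A ⊆ B := by
      rintro u ⟨hu, huA⟩
      have huA : s - |u 0| ≤ R - |u 0 - c 0| := huA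
      have hu := (memI u).1 hu
      exact (memB u).2 (bound _ _ (by linarith) (by linarith))
    have hsub2 : T ⊆ B := by
      rintro u ⟨hu, huA⟩
      have huA : ¬ s - |(u + w) 0| ≤ R - |(u + w) 0 - c 0| := huA
      have hu := (memI (u + w)).1 hu
      simp only [Pi.add_apply, hw0, hws, add_zero, add_sub_cancel_right] at hu huA
      exact (memB u).2 (bound _ _ (by linarith) (by linarith))
    have hdisj : Disjoint (I ∩ A) T := by
      refine disjoint_left.2 ?_
      rintro u ⟨-, huA⟩ ⟨-, hu⟩
      refine hu ?_
      change s - |(u + w) 0| ≤ R - |(u + w) 0 - c 0|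
      rw [Pi.add_apply, hw0, add_zero]
      exact huA
    refine ⟨m, ?_⟩
    calc volume.real I = volume.real (I ∩ A) + volume.real (I \ A) :=
          (measureReal_inter_add_sdiff hAm hIt).symm
      _ = volume.real (I ∩ A ∪ T) := by
          rw [← hTv, measureReal_union hdisj hTm (measure_ne_top_of_subset hsub1 hBt)
            (measure_ne_top_of_subset hsub2 hBt)]
      _ ≤ volume.real B := measureReal_mono (union_subset hsub1 hsub2) hBt

/-- For every dimension `d` and every modulus of continuity `ω`, the operator norm of the
uncentered maximal operator on `Lip(ω)` is the same for the `ℓ₁` norm (cross-polytopes,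
`ℓ₁` distances) as for the `ℓ∞` norm (axis-parallel cubes, `ℓ∞` distances). -/
theorem stmt18 (d : ℕ) (hd : 1 ≤ d) (ω : ℝ → ℝ) (hω : IsModulus ω) :
    opNorm d (fun x => ∑ i, |x i|) ω = opNorm d (fun x => ‖x‖) ω := by
  obtain ⟨n, rfl⟩ := Nat.exists_eq_add_of_le' hd
  exact le_antisymm
    ((isExtremalDirection_norm hd).opNorm_le hd (isDominatingNorm_norm _)
      (isDominatingNorm_sum_abs _) hω)
    ((isExtremalDirection_sum_abs n).opNorm_le hd (isDominatingNorm_sum_abs _)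
      (isDominatingNorm_norm _) hω)
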